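/- arXiv:2307.01143 — 2 statements merged into one kernel-verified Lean document; each statement's English description precedes it below -/
import Mathlib

section
/- For any ω-poset P the following are equivalent: (1) each level P_n is a minimal cap, i.e. a cap no proper subset of which is a cap; (2) for all m ≤ n, the restriction of ≤ to pairs in P_n × P_m is injective as a relation, i.e. for every p ∈ P_m there exists q ∈ P_n such that p is the unique element of P_m with q ≤ p; (3) for every m ∈ ω, the set of n ∈ ω for which the restriction of ≤ to P_n × P_m is injective in this sense is cofinal in ω. -/
/-- `A` refines `B`: every element of `A` lies below some element of `B`. -/
def Refines {α : Type*} [PartialOrder α] (A B : Set α) : Prop :=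
  ∀ a ∈ A, ∃ b ∈ B, a ≤ b

/-- A band: a finite subset such that every element of the poset is comparable with some member. -/
def IsBand {α : Type*} [PartialOrder α] (B : Set α) : Prop :=
  B.Finite ∧ ∀ p : α, ∃ b ∈ B, p ≤ b ∨ b ≤ p

/-- A cap: a subset refined by some band. -/
def IsCap {α : Type*} [PartialOrder α] (C : Set α) : Prop :=
  ∃ B : Set α, IsBand B ∧ Refines B C

/-- A minimal cap: a cap no proper subset of which is a cap. -/
def IsMinimalCap {α : Type*} [PartialOrder α] (C : Set α) : Prop :=
  IsCap C ∧ ∀ D : Set α, D ⊂ C → ¬ IsCap D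

/-- A selector: a subset meeting every cap. -/
def IsSelector {α : Type*} [PartialOrder α] (S : Set α) : Prop :=
  ∀ C : Set α, IsCap C → (S ∩ C).Nonempty

/-- A minimal selector: a selector minimal under inclusion among selectors. -/
def IsMinSelector {α : Type*} [PartialOrder α] (S : Set α) : Prop :=
  IsSelector S ∧ ∀ T : Set α, T ⊆ S → IsSelector T → T = S

/-- An ω-poset: every principal filter is finite, and for each `n` only finitely many
principal filters have exactly `n` elements. -/
def IsOmegaPoset (α : Type*) [PartialOrder α] : Prop :=
  (∀ p : α, (Set.Ici p).Finite) ∧ ∀ n : ℕ, {p : α | (Set.Ici p).ncard = n}.Finite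

/-- The rank of `p`: the length of the longest strictly increasing chain starting at `p`,
i.e. `r(p) = sup_{q > p} (r(q) + 1)`. -/
noncomputable def chainRank {α : Type*} [PartialOrder α] (p : α) : ℕ :=
  sSup {n : ℕ | ∃ c : ℕ → α, c 0 = p ∧ ∀ i < n, c i < c (i + 1)}

/-- The `n`-th level: the minimal elements of the `n`-th cone `{p | chainRank p ≤ n}`. -/
def levelSet (α : Type*) [PartialOrder α] (n : ℕ) : Set α :=
  {p : α | chainRank p ≤ n ∧ ∀ q : α, q < p → ¬ chainRank q ≤ n}

/-- Predetermined: every non-minimal `p` has some `q < p` all of whose strict upper bounds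
lie above `p`. -/
def Predetermined (α : Type*) [PartialOrder α] : Prop :=
  ∀ p : α, ¬ IsMin p → ∃ q : α, q < p ∧ ∀ r : α, q < r → p ≤ r

/-- Branching. -/
def Branching (α : Type*) [PartialOrder α] : Prop :=
  ∀ p q : α, p < q → ∃ r : α, r < q ∧ ¬ r ≤ p ∧ ¬ p ≤ r

/-- The cap-order on elements: `p ≾ q` iff adding `q` to any family keeping `p` a cap keeps a cap. -/
def CapBelow {α : Type*} [PartialOrder α] (p q : α) : Prop :=
  ∀ F : Set α, IsCap (F ∪ {p}) → IsCap (F ∪ {q})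

/-- Cap-determined: the cap-order on elements agrees with the order. -/
def CapDetermined (α : Type*) [PartialOrder α] : Prop :=
  ∀ p q : α, CapBelow p q → p ≤ q

/-- Graded: immediate predecessors have rank exactly one more. -/
def GradedPoset (α : Type*) [PartialOrder α] : Prop :=
  ∀ p q : α, p ⋖ q → chainRank p = chainRank q + 1

/-- `Wedge p q`: `p` and `q` have a common lower bound. -/
def Wedge {α : Type*} [PartialOrder α] (p q : α) : Prop :=
  ∃ r : α, r ≤ p ∧ r ≤ q

/-- Star-below: `p ◁ q` iff there is a cap `C` with every element of the star `Cp` below `q`. -/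
def StarBelow {α : Type*} [PartialOrder α] (p q : α) : Prop :=
  ∃ C : Set α, IsCap C ∧ ∀ c ∈ C, Wedge c p → c ≤ q

/-- Regular: every cap is ◁-refined by some cap. -/
def RegularPoset (α : Type*) [PartialOrder α] : Prop :=
  ∀ C : Set α, IsCap C → ∃ D : Set α, IsCap D ∧ ∀ d ∈ D, ∃ c ∈ C, StarBelow d c

/-- Prime: for every `p` there is `F` with `F ∪ {p}` a cap but `F` not a cap. -/
def PrimePoset (α : Type*) [PartialOrder α] : Prop :=
  ∀ p : α, ∃ F : Set α, IsCap (F ∪ {p}) ∧ ¬ IsCap F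

/-- Cluster: connected with respect to the common-lower-bound relation. -/
def IsCluster {α : Type*} [PartialOrder α] (C : Set α) : Prop :=
  ∀ A B : Set α, A.Nonempty → B.Nonempty → A ∪ B = C → ∃ a ∈ A, ∃ b ∈ B, Wedge a b

/-- `D^{≤_B ≥}`: the elements sharing an upper bound in `B` with some element of `D`. -/
def SharedUpper {α : Type*} [PartialOrder α] (D B : Set α) : Set α :=
  {p : α | ∃ d ∈ D, ∃ b ∈ B, p ≤ b ∧ d ≤ b}

/-- Weakly tangled refinement. -/
def WeaklyTangledRefinement {α : Type*} [PartialOrder α] (A B : Set α) : Prop :=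
  Refines A B ∧ ∀ C D : Set α, C ⊆ A → D ⊆ A → IsCluster C → IsCluster D →
    (C ∩ D).Nonempty → C ⊆ SharedUpper D B ∨ D ⊆ SharedUpper C B

/-- Weakly tangled poset: every cap has a weakly tangled refinement which is a cap. -/
def WeaklyTangled (α : Type*) [PartialOrder α] : Prop :=
  ∀ C : Set α, IsCap C → ∃ A : Set α, IsCap A ∧ WeaklyTangledRefinement A C

/-- Injectivity of `≤` from level `n` to level `m`: every `p` in level `m` has a witness
`q` in level `n` below `p` and below no other element of level `m`. -/
def LevelInjOn (α : Type*) [PartialOrder α] (m n : ℕ) : Prop :=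
  ∀ p ∈ levelSet α m, ∃ q ∈ levelSet α n,
    q ≤ p ∧ ∀ p' ∈ levelSet α m, q ≤ p' → p' = p

/-- The spectrum: the set of minimal selectors. -/
def Spectrum (α : Type*) [PartialOrder α] : Type _ :=
  {S : Set α // IsMinSelector S}

/-- The topology on the spectrum generated by the sets `p^∈ = {S | p ∈ S}`. -/
instance {α : Type*} [PartialOrder α] : TopologicalSpace (Spectrum α) :=
  TopologicalSpace.generateFrom
    {U : Set (Spectrum α) | ∃ p : α, U = {S : Spectrum α | p ∈ S.1}}

/-- A basis of nonempty (open) sets. -/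
def IsNeBasis {X : Type*} [TopologicalSpace X] (P : Set (Set X)) : Prop :=
  TopologicalSpace.IsTopologicalBasis P ∧ ∀ p ∈ P, p.Nonempty

/-- Cap-basis: a basis of nonempty open sets whose caps (under inclusion) are exactly
the covers of the space. -/
def IsCapBasis {X : Type*} [TopologicalSpace X] (P : Set (Set X)) : Prop :=
  IsNeBasis P ∧ ∀ C : Set ↥P, (IsCap C ↔ (⋃ c ∈ C, (c : Set X)) = Set.univ)

/-- Band-basis: a basis of nonempty open sets whose bands (under inclusion) are exactly
the finite covers of the space. -/
def IsBandBasis {X : Type*} [TopologicalSpace X] (P : Set (Set X)) : Prop :=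
  IsNeBasis P ∧ ∀ B : Set ↥P, (IsBand B ↔ B.Finite ∧ (⋃ b ∈ B, (b : Set X)) = Set.univ)

section ChainRank

variable {α : Type*} [PartialOrder α]

theorem chain_length_lt_ncard_Ici (hf : ∀ p : α, (Set.Ici p).Finite) (n : ℕ) :
    ∀ p : α, (∃ c : ℕ → α, c 0 = p ∧ ∀ i < n, c i < c (i + 1)) → n < (Set.Ici p).ncard := by
  induction n with
  | zero =>
    intro p _
    exact (Set.ncard_pos (hf p)).2 ⟨p, le_refl p⟩
  | succ n ih =>
    rintro p ⟨c, rfl, hc⟩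
    have h₁ : n < (Set.Ici (c 1)).ncard :=
      ih (c 1) ⟨fun i => c (i + 1), rfl, fun i hi => hc (i + 1) (by omega)⟩
    have h₂ : (Set.Ici (c 1)).ncard < (Set.Ici (c 0)).ncard :=
      Set.ncard_lt_ncard (Set.Ici_ssubset_Ici.2 (hc 0 (by omega))) (hf _)
    omega

theorem bddAbove_chain_lengths (hf : ∀ p : α, (Set.Ici p).Finite) (p : α) :
    BddAbove {n : ℕ | ∃ c : ℕ → α, c 0 = p ∧ ∀ i < n, c i < c (i + 1)} :=
  ⟨(Set.Ici p).ncard, fun n hn => (chain_length_lt_ncard_Ici hf n p hn).le⟩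

theorem exists_chain_of_chainRank (hf : ∀ p : α, (Set.Ici p).Finite) (p : α) :
    ∃ c : ℕ → α, c 0 = p ∧ ∀ i < chainRank p, c i < c (i + 1) :=
  Nat.sSup_mem (s := {n : ℕ | ∃ c : ℕ → α, c 0 = p ∧ ∀ i < n, c i < c (i + 1)})
    ⟨0, fun _ => p, rfl, fun _ hi => absurd hi (Nat.not_lt_zero _)⟩ (bddAbove_chain_lengths hf p)

theorem le_chainRank (hf : ∀ p : α, (Set.Ici p).Finite) {p : α} {n : ℕ}
    (hn : ∃ c : ℕ → α, c 0 = p ∧ ∀ i < n, c i < c (i + 1)) : n ≤ chainRank p :=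
  le_csSup (bddAbove_chain_lengths hf p) hn

theorem chainRank_lt_of_lt (hf : ∀ p : α, (Set.Ici p).Finite) {p q : α} (hqp : q < p) :
    chainRank p < chainRank q := by
  obtain ⟨c, rfl, hc⟩ := exists_chain_of_chainRank hf p
  refine le_chainRank hf ⟨fun i => Nat.casesOn i q c, rfl, ?_⟩
  rintro (_ | i) hi
  · exact hqp
  · exact hc i (by omega)

theorem exists_gt_chainRank_eq (hf : ∀ p : α, (Set.Ici p).Finite) {p : α} {n : ℕ}
    (hp : chainRank p = n + 1) : ∃ q, p < q ∧ chainRank q = n := by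
  obtain ⟨c, h0, hc⟩ := exists_chain_of_chainRank hf p
  rw [hp] at hc
  have hlt : p < c 1 := h0 ▸ hc 0 (by omega)
  have hle : n ≤ chainRank (c 1) :=
    le_chainRank hf ⟨fun i => c (i + 1), rfl, fun i hi => hc (i + 1) (by omega)⟩
  have := chainRank_lt_of_lt hf hlt
  exact ⟨c 1, hlt, by omega⟩

theorem exists_ge_chainRank_eq (hf : ∀ p : α, (Set.Ici p).Finite) {n k : ℕ} (hnk : n ≤ k) :
    ∀ p : α, chainRank p = k → ∃ q, p ≤ q ∧ chainRank q = n := by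
  induction k, hnk using Nat.le_induction with
  | base => exact fun p hp => ⟨p, le_rfl, hp⟩
  | succ k _ ih =>
    intro p hp
    obtain ⟨q, hpq, hq⟩ := exists_gt_chainRank_eq hf hp
    obtain ⟨r, hqr, hr⟩ := ih q hq
    exact ⟨r, hpq.le.trans hqr, hr⟩

theorem IsOmegaPoset.finite_setOf_Ioi_subset (h : IsOmegaPoset α) {T : Set α} (hT : T.Finite) :
    {p : α | Set.Ioi p ⊆ T}.Finite := by
  refine ((Set.finite_Iic (T.ncard + 1)).biUnion fun k _ => h.2 k).subset fun p hp => ?_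
  have hle : (Set.Ici p).ncard ≤ T.ncard + 1 := by
    rw [← Set.Ioi_insert]
    exact (Set.ncard_insert_le p _).trans (Nat.add_le_add_right (Set.ncard_le_ncard hp hT) 1)
  exact Set.mem_biUnion (Set.mem_Iic.2 hle) rfl

theorem IsOmegaPoset.finite_cone (h : IsOmegaPoset α) (n : ℕ) :
    {p : α | chainRank p ≤ n}.Finite := by
  induction n with
  | zero =>
    refine (h.finite_setOf_Ioi_subset Set.finite_empty).subset fun p hp q hq => ?_
    exact absurd (chainRank_lt_of_lt h.1 hq) (by simp_all)
  | succ n ih =>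
    refine (h.finite_setOf_Ioi_subset ih).subset fun p hp q hq => ?_
    exact Nat.lt_succ_iff.1 ((chainRank_lt_of_lt h.1 hq).trans_le hp)

theorem mem_levelSet_of_chainRank_eq (hf : ∀ p : α, (Set.Ici p).Finite) {p : α} {n : ℕ}
    (hp : chainRank p = n) : p ∈ levelSet α n :=
  ⟨hp.le, fun _ hq => not_le.2 (hp ▸ chainRank_lt_of_lt hf hq)⟩

theorem exists_mem_levelSet_ge (hf : ∀ p : α, (Set.Ici p).Finite) {p : α} {n : ℕ}
    (hp : n ≤ chainRank p) : ∃ q ∈ levelSet α n, p ≤ q := by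
  obtain ⟨q, hpq, hq⟩ := exists_ge_chainRank_eq hf hp p rfl
  exact ⟨q, mem_levelSet_of_chainRank_eq hf hq, hpq⟩

theorem IsOmegaPoset.exists_mem_levelSet_le (h : IsOmegaPoset α) {p : α} {n : ℕ}
    (hp : chainRank p ≤ n) : ∃ q ∈ levelSet α n, q ≤ p := by
  obtain ⟨q, hqp, hq⟩ := (h.finite_cone n).exists_le_minimal hp
  exact ⟨q, ⟨hq.1, fun r hr hrn => hr.not_ge (hq.2 hrn hr.le)⟩, hqp⟩

theorem IsOmegaPoset.isBand_levelSet (h : IsOmegaPoset α) (n : ℕ) : IsBand (levelSet α n) := by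
  refine ⟨(h.finite_cone n).subset fun p hp => hp.1, fun p => ?_⟩
  rcases le_total (chainRank p) n with hp | hp
  · obtain ⟨q, hq, hqp⟩ := h.exists_mem_levelSet_le hp
    exact ⟨q, hq, Or.inr hqp⟩
  · obtain ⟨q, hq, hpq⟩ := exists_mem_levelSet_ge h.1 hp
    exact ⟨q, hq, Or.inl hpq⟩

theorem refines_levelSet_of_le (hf : ∀ p : α, (Set.Ici p).Finite) {m n : ℕ} (hmn : m ≤ n) :
    Refines (levelSet α n) (levelSet α m) := by
  intro p hp
  rcases le_total m (chainRank p) with hm | hm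
  · exact exists_mem_levelSet_ge hf hm
  · exact ⟨p, ⟨hm, fun q hq hqm => hp.2 q hq (hqm.trans hmn)⟩, le_rfl⟩

theorem IsCap.exists_forall_refines_levelSet {C : Set α} (hC : IsCap C) :
    ∃ N : ℕ, ∀ n, N ≤ n → Refines (levelSet α n) C := by
  obtain ⟨B, ⟨hBf, hB⟩, hBC⟩ := hC
  obtain ⟨N, hN⟩ := (hBf.image chainRank).bddAbove
  refine ⟨N, fun n hn p hp => ?_⟩
  obtain ⟨b, hb, hpb⟩ := hB p
  have hle : p ≤ b := by
    refine hpb.elim id fun hbp => ?_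
    by_contra hnot
    exact hp.2 b (lt_of_le_not_ge hbp hnot) ((hN ⟨b, hb, rfl⟩).trans hn)
  obtain ⟨c, hc, hbc⟩ := hBC b hb
  exact ⟨c, hc, hle.trans hbc⟩

theorem IsOmegaPoset.levelInjOn_of_isMinimalCap (h : IsOmegaPoset α) {m n : ℕ} (hmn : m ≤ n)
    (hm : IsMinimalCap (levelSet α m)) : LevelInjOn α m n := by
  intro p hp
  by_contra! hnot
  refine hm.2 _ (Set.sdiff_singleton_ssubset.2 hp) ⟨_, h.isBand_levelSet n, fun q hq => ?_⟩
  by_cases hqp : q ≤ p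
  · obtain ⟨p', hp', hqp', hne⟩ := hnot q hq hqp
    exact ⟨p', ⟨hp', hne⟩, hqp'⟩
  · obtain ⟨p', hp', hqp'⟩ := refines_levelSet_of_le h.1 hmn q hq
    exact ⟨p', ⟨hp', fun he => hqp (he ▸ hqp')⟩, hqp'⟩

theorem IsOmegaPoset.isMinimalCap_levelSet (h : IsOmegaPoset α) {m : ℕ}
    (hm : ∀ N : ℕ, ∃ n : ℕ, N ≤ n ∧ LevelInjOn α m n) : IsMinimalCap (levelSet α m) := by
  refine ⟨⟨_, h.isBand_levelSet m, fun p hp => ⟨p, hp, le_rfl⟩⟩, fun D hD hcap => ?_⟩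
  obtain ⟨p, hp, hpD⟩ := Set.exists_of_ssubset hD
  obtain ⟨N, hN⟩ := hcap.exists_forall_refines_levelSet
  obtain ⟨n, hn, hinj⟩ := hm N
  obtain ⟨q, hq, _, huniq⟩ := hinj p hp
  obtain ⟨d, hd, hqd⟩ := hN n hn q hq
  exact hpD (huniq d (hD.1 hd) hqd ▸ hd)

end ChainRank

/-- In an ω-poset, all levels are minimal caps iff `≤` is injective from
level `n` to level `m` whenever `m ≤ n`, iff for each `m` the set of such `n` is cofinal. -/
theorem level_injective_tfae {α : Type*} [PartialOrder α] (h : IsOmegaPoset α) :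
    ((∀ n : ℕ, IsMinimalCap (levelSet α n)) ↔
      (∀ m n : ℕ, m ≤ n → LevelInjOn α m n)) ∧
    ((∀ m n : ℕ, m ≤ n → LevelInjOn α m n) ↔
      (∀ m N : ℕ, ∃ n : ℕ, N ≤ n ∧ LevelInjOn α m n)) := by
  have h₂₃ : (∀ m n : ℕ, m ≤ n → LevelInjOn α m n) →
      ∀ m N : ℕ, ∃ n : ℕ, N ≤ n ∧ LevelInjOn α m n := fun hinj m N =>
    ⟨max m N, le_max_right m N, hinj m _ (le_max_left m N)⟩
  have h₁₂ : (∀ n : ℕ, IsMinimalCap (levelSet α n)) →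
      ∀ m n : ℕ, m ≤ n → LevelInjOn α m n := fun hcap m _ hmn =>
    h.levelInjOn_of_isMinimalCap hmn (hcap m)
  have h₃₁ : (∀ m N : ℕ, ∃ n : ℕ, N ≤ n ∧ LevelInjOn α m n) →
      ∀ n : ℕ, IsMinimalCap (levelSet α n) := fun hcof m =>
    h.isMinimalCap_levelSet (hcof m)
  exact ⟨⟨h₁₂, h₃₁ ∘ h₂₃⟩, ⟨h₂₃, h₁₂ ∘ h₃₁⟩⟩
end

section
/- For any poset P, the spectrum SP is a compact T1 topological space. Moreover, a subset C ⊆ P is a cap of P if and only if the family of open sets {c^∈ : c ∈ C} covers SP. -/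
theorem IsCap.mono {α : Type*} [PartialOrder α] {C D : Set α} (hC : IsCap C) (h : C ⊆ D) :
    IsCap D := by
  obtain ⟨B, hB, hBC⟩ := hC
  refine ⟨B, hB, fun b hb => ?_⟩
  obtain ⟨c, hc, hbc⟩ := hBC b hb
  exact ⟨c, h hc, hbc⟩

theorem IsCap.exists_finite_subset {α : Type*} [PartialOrder α] {C : Set α} (hC : IsCap C) :
    ∃ F ⊆ C, F.Finite ∧ IsCap F := by
  obtain ⟨B, hB, hBC⟩ := hC
  choose! f hf hle using hBC
  exact ⟨f '' B, Set.image_subset_iff.2 hf, hB.1.image f, B, hB,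
    fun b hb => ⟨f b, Set.mem_image_of_mem f hb, hle b hb⟩⟩

/-- A nonempty chain of sets, each meeting the finite set `F`, has an intersection meeting `F`. -/
theorem IsChain.sInter_inter_nonempty {α : Type*} {c : Set (Set α)} (hc : IsChain (· ⊆ ·) c)
    (hne : c.Nonempty) {F : Set α} (hF : F.Finite) (h : ∀ S ∈ c, (S ∩ F).Nonempty) :
    (⋂₀ c ∩ F).Nonempty := by
  have hfin : ((fun S => S ∩ F) '' c).Finite :=
    hF.finite_subsets.subset (by rintro _ ⟨S, -, rfl⟩; exact Set.inter_subset_right)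
  obtain ⟨M, hM⟩ := hfin.exists_minimal (hne.image _)
  obtain ⟨⟨S, hS, rfl⟩, hmin⟩ := hM
  obtain ⟨x, hxS, hxF⟩ := h S hS
  refine ⟨x, fun T hT => ?_, hxF⟩
  rcases hc.total hS hT with hST | hTS
  · exact hST hxS
  · exact (hmin (Set.mem_image_of_mem _ hT) (Set.inter_subset_inter_left F hTS) ⟨hxS, hxF⟩).1

theorem IsSelector.exists_minSelector_subset {α : Type*} [PartialOrder α] {S : Set α}
    (hS : IsSelector S) : ∃ T ⊆ S, IsMinSelector T := by
  obtain ⟨T, hTS, hT⟩ := zorn_superset_nonempty {T : Set α | IsSelector T}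
    (fun c hcS hc hne => ⟨⋂₀ c, fun C hC => by
      obtain ⟨F, hFC, hF, hFcap⟩ := hC.exists_finite_subset
      exact (hc.sInter_inter_nonempty hne hF fun T hT => hcS hT F hFcap).mono
        (Set.inter_subset_inter_right _ hFC), fun _ => Set.sInter_subset_of_mem⟩) S hS
  exact ⟨T, hTS, hT.prop, fun U hUT hU => hUT.antisymm (hT.le_of_le hU hUT)⟩

theorem isSelector_compl_of_not_isCap {α : Type*} [PartialOrder α] {C : Set α}
    (hC : ¬ IsCap C) : IsSelector Cᶜ := by
  intro D hD
  by_contra h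
  exact hC (hD.mono fun d hd => by_contra fun hdC => h ⟨d, hdC, hd⟩)

theorem isCap_iff_iUnion_eq_univ {α : Type*} [PartialOrder α] (C : Set α) :
    IsCap C ↔ (⋃ c ∈ C, {S : Spectrum α | c ∈ S.1}) = Set.univ := by
  refine ⟨fun hC => Set.eq_univ_of_forall fun S => ?_, fun h => ?_⟩
  · obtain ⟨c, hcS, hcC⟩ := S.2.1 C hC
    exact Set.mem_biUnion hcC hcS
  · by_contra hC
    obtain ⟨T, hT, hTmin⟩ := (isSelector_compl_of_not_isCap hC).exists_minSelector_subset
    have hmem := h.ge (Set.mem_univ (⟨T, hTmin⟩ : Spectrum α))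
    obtain ⟨c, hc, hcT⟩ := Set.mem_iUnion₂.1 hmem
    exact hT hcT hc

theorem isOpen_setOf_mem_spectrum {α : Type*} [PartialOrder α] (p : α) :
    IsOpen {S : Spectrum α | p ∈ S.1} :=
  TopologicalSpace.isOpen_generateFrom_of_mem ⟨p, rfl⟩

theorem Spectrum.t1Space {α : Type*} [PartialOrder α] : T1Space (Spectrum α) := by
  refine t1Space_iff_exists_open.2 fun S T hST => ?_
  obtain ⟨p, hpS, hpT⟩ : ∃ p ∈ S.1, p ∉ T.1 :=
    Set.not_subset.1 fun h => hST (Subtype.ext (T.2.2 S.1 h S.2.1))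
  exact ⟨_, isOpen_setOf_mem_spectrum p, hpS, hpT⟩

theorem Spectrum.compactSpace {α : Type*} [PartialOrder α] : CompactSpace (Spectrum α) := by
  refine ⟨isCompact_generateFrom rfl fun Q hQ hcover => ?_⟩
  have hcap : IsCap {p : α | {S : Spectrum α | p ∈ S.1} ∈ Q} := by
    refine (isCap_iff_iUnion_eq_univ _).2 (Set.eq_univ_of_forall fun S => ?_)
    obtain ⟨U, hU, hSU⟩ := hcover (Set.mem_univ S)
    obtain ⟨p, rfl⟩ := hQ hU
    exact Set.mem_biUnion hU hSU
  obtain ⟨F, hFsub, hF, hFcap⟩ := hcap.exists_finite_subset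
  refine ⟨(fun p => {S : Spectrum α | p ∈ S.1}) '' F, Set.image_subset_iff.2 hFsub,
    hF.image _, ?_⟩
  rw [Set.sUnion_image]
  exact ((isCap_iff_iUnion_eq_univ F).1 hFcap).ge

/-- The spectrum is a compact T1 space, and a subset is a cap iff the
corresponding subbasic open sets cover the spectrum. -/
theorem spectrum_compact_t1 {α : Type*} [PartialOrder α] :
    CompactSpace (Spectrum α) ∧ T1Space (Spectrum α) ∧
    ∀ C : Set α,
      (IsCap C ↔ (⋃ c ∈ C, {S : Spectrum α | c ∈ S.1}) = Set.univ) :=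
  ⟨Spectrum.compactSpace, Spectrum.t1Space, isCap_iff_iUnion_eq_univ⟩
end
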